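/- Fix an integer n ≥ 1 and work over F₂ with the specializations C̄_n and Ē_n obtained from C_n and E_n by setting U = V = 1, and their F₂-linear duals (basis elements with out-of-range index are interpreted as 0). Define the F₂-linear map ψ : Ē_n^∨ → C̄_n^∨ ⊗ C̄_n^∨ by: ψ(z^∨_ℓ) = Σ_{i+j=ℓ, i,j odd} y^∨_i⊗y^∨_j; ψ(w^∨_k) = Σ_{i+j=k, i even, j odd} (x^∨_i⊗y^∨_j + y^∨_j⊗x^∨_i); ψ(r^∨₋₁) = Σ_{i+j=0, i<j, i,j odd} (x^∨_{i−1}⊗y^∨_j + y^∨_i⊗x^∨_{j−1}); ψ(r^∨₁) = Σ_{i+j=0, i<j, i,j odd} (x^∨_{i+1}⊗y^∨_j + y^∨_i⊗x^∨_{j+1}); ψ(r^∨₀) = x^∨₀⊗x^∨₀; ψ(t^∨) = Σ_{i+j=0, i<j, i,j odd} y^∨_i⊗y^∨_j. Then ψ is a chain map (∂∘ψ = ψ∘∂) and is equivariant: ψ∘τ_E^∨ = (τ^∨⊗τ^∨)∘ψ. -/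

import Mathlib

open Finsupp

/-- The field with two elements. -/
abbrev F2 : Type := ZMod 2

/-! Basis index types for the specializations at `U = V = 1` of the staircase complexes
`C_n` and `E_n = D_n ⊕ S_n`. -/

abbrev XIdx (n : ℤ) := {k : ℤ // k % 2 = 0 ∧ -(2*n - 2) ≤ k ∧ k ≤ 2*n - 2}
abbrev YIdx (n : ℤ) := {l : ℤ // l % 2 = 1 ∧ -(2*n - 1) ≤ l ∧ l ≤ 2*n - 1}
abbrev CB (n : ℤ) := XIdx n ⊕ YIdx n

abbrev WIdx (n : ℤ) := {k : ℤ // k % 2 = 1 ∧ -(4*n - 3) ≤ k ∧ k ≤ 4*n - 3}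
abbrev ZIdx (n : ℤ) := {l : ℤ // l % 2 = 0 ∧ -(4*n - 2) ≤ l ∧ l ≤ 4*n - 2}

/-- Basis of the square part: `r₀, r₋₁, r₁, t`. -/
inductive SB : Type | r0 : SB | rm : SB | rp : SB | t : SB

abbrev EB (n : ℤ) := (WIdx n ⊕ ZIdx n) ⊕ SB

/-- The `F₂`-linear dual `C̄_n^∨` of the specialization `C̄_n`, realized on the dual
basis `{x^∨_k, y^∨_ℓ}`. -/
abbrev Cd (n : ℤ) : Type := CB n →₀ F2

/-- The `F₂`-linear dual `Ē_n^∨`, realized on the dual basis. -/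
abbrev Ed (n : ℤ) : Type := EB n →₀ F2

/-- The concrete realization of `C̄_n^∨ ⊗ C̄_n^∨`. -/
abbrev Td (n : ℤ) : Type := (CB n × CB n) →₀ F2

/-- The dual basis element `x^∨_k` (interpreted as `0` for out-of-range index). -/
noncomputable def xd (n k : ℤ) : Cd n :=
  if h : k % 2 = 0 ∧ -(2*n - 2) ≤ k ∧ k ≤ 2*n - 2 then single (.inl ⟨k, h⟩) 1 else 0

/-- The dual basis element `y^∨_ℓ` (interpreted as `0` for out-of-range index). -/
noncomputable def yd (n l : ℤ) : Cd n :=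
  if h : l % 2 = 1 ∧ -(2*n - 1) ≤ l ∧ l ≤ 2*n - 1 then single (.inr ⟨l, h⟩) 1 else 0

/-- The dual basis element `w^∨_k` (interpreted as `0` for out-of-range index). -/
noncomputable def wd (n k : ℤ) : Ed n :=
  if h : k % 2 = 1 ∧ -(4*n - 3) ≤ k ∧ k ≤ 4*n - 3 then single (.inl (.inl ⟨k, h⟩)) 1 else 0

/-- The dual basis element `z^∨_ℓ` (interpreted as `0` for out-of-range index). -/
noncomputable def zd (n l : ℤ) : Ed n :=
  if h : l % 2 = 0 ∧ -(4*n - 2) ≤ l ∧ l ≤ 4*n - 2 then single (.inl (.inr ⟨l, h⟩)) 1 else 0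

/-- The dual basis elements `r^∨₀, r^∨₋₁, r^∨₁, t^∨`. -/
noncomputable def sd (n : ℤ) (s : SB) : Ed n := single (.inr s) 1

/-- The transpose differential of `C̄_n^∨`: `∂y^∨_ℓ = x^∨_{ℓ−1} + x^∨_{ℓ+1}`,
`∂x^∨_k = 0`. -/
noncomputable def dCd (n : ℤ) : Cd n →ₗ[F2] Cd n :=
  linearCombination F2 fun b => match b with
  | .inl _ => 0
  | .inr ⟨l, _⟩ => xd n (l - 1) + xd n (l + 1)

/-- The transpose differential of `Ē_n^∨`: `∂z^∨_ℓ = w^∨_{ℓ−1} + w^∨_{ℓ+1}`,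
`∂w^∨_k = 0`, `∂t^∨ = r^∨₋₁ + r^∨₁`, `∂r^∨₋₁ = ∂r^∨₁ = r^∨₀`, `∂r^∨₀ = 0`. -/
noncomputable def dEd (n : ℤ) : Ed n →ₗ[F2] Ed n :=
  linearCombination F2 fun b => match b with
  | .inl (.inl _) => 0
  | .inl (.inr ⟨l, _⟩) => wd n (l - 1) + wd n (l + 1)
  | .inr SB.r0 => 0
  | .inr SB.rm => sd n SB.r0
  | .inr SB.rp => sd n SB.r0
  | .inr SB.t => sd n SB.rm + sd n SB.rp

/-- The transpose `τ^∨` of the reflection involution of `C̄_n`: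
`τ^∨(x^∨_k) = x^∨_{−k}`, `τ^∨(y^∨_ℓ) = y^∨_{−ℓ}`. -/
noncomputable def τCd (n : ℤ) : Cd n →ₗ[F2] Cd n :=
  linearCombination F2 fun b => match b with
  | .inl ⟨k, _⟩ => xd n (-k)
  | .inr ⟨l, _⟩ => yd n (-l)

/-- The transpose `τ_E^∨` of the involution `τ_E` of `Ē_n`:
`τ_E^∨(w^∨_k) = w^∨_{−k}`, `τ_E^∨(z^∨_ℓ) = z^∨_{−ℓ}` for `ℓ ≠ 0`,
`τ_E^∨(z^∨₀) = z^∨₀`, `τ_E^∨(t^∨) = t^∨ + z^∨₀`, `τ_E^∨(r^∨₀) = r^∨₀`,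
`τ_E^∨(r^∨₋₁) = r^∨₁ + w^∨₁`, `τ_E^∨(r^∨₁) = r^∨₋₁ + w^∨₋₁`. -/
noncomputable def τEd (n : ℤ) : Ed n →ₗ[F2] Ed n :=
  linearCombination F2 fun b => match b with
  | .inl (.inl ⟨k, _⟩) => wd n (-k)
  | .inl (.inr ⟨l, _⟩) => if l = 0 then zd n 0 else zd n (-l)
  | .inr SB.r0 => sd n SB.r0
  | .inr SB.rm => sd n SB.rp + wd n 1
  | .inr SB.rp => sd n SB.rm + wd n (-1)
  | .inr SB.t => sd n SB.t + zd n 0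

/-- The tensor product of two elements of `C̄_n^∨`, in the concrete realization of
`C̄_n^∨ ⊗ C̄_n^∨`. -/
noncomputable def tp {n : ℤ} (f g : Cd n) : Td n :=
  f.sum fun a c => g.sum fun b c' => Finsupp.single (a, b) (c * c')

/-- The differential of `C̄_n^∨ ⊗ C̄_n^∨` (i.e. `∂ ⊗ id + id ⊗ ∂`). -/
noncomputable def dTd (n : ℤ) : Td n →ₗ[F2] Td n :=
  linearCombination F2 fun p =>
    tp (dCd n (single p.1 1)) (single p.2 1) + tp (single p.1 1) (dCd n (single p.2 1))

/-- The map `τ^∨ ⊗ τ^∨` on `C̄_n^∨ ⊗ C̄_n^∨`. -/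
noncomputable def ττd (n : ℤ) : Td n →ₗ[F2] Td n :=
  linearCombination F2 fun p => tp (τCd n (single p.1 1)) (τCd n (single p.2 1))

/-- The map `ψ : Ē_n^∨ → C̄_n^∨ ⊗ C̄_n^∨` of Statement 9.  (All sums are written over
an interval of integers; the summands with an out-of-range or wrong-parity index
vanish, since such dual basis elements are interpreted as `0`.) -/
noncomputable def ψ (n : ℤ) : Ed n →ₗ[F2] Td n :=
  linearCombination F2 fun b => match b with
  | .inl (.inl ⟨k, _⟩) =>
      ∑ i ∈ Finset.Icc (-(2*n - 2)) (2*n - 2),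
        (tp (xd n i) (yd n (k - i)) + tp (yd n (k - i)) (xd n i))
  | .inl (.inr ⟨l, _⟩) =>
      ∑ i ∈ Finset.Icc (-(2*n - 1)) (2*n - 1), tp (yd n i) (yd n (l - i))
  | .inr SB.r0 => tp (xd n 0) (xd n 0)
  | .inr SB.rm =>
      ∑ i ∈ Finset.Icc (-(2*n - 1)) (-1),
        (tp (xd n (i - 1)) (yd n (-i)) + tp (yd n i) (xd n (-i - 1)))
  | .inr SB.rp =>
      ∑ i ∈ Finset.Icc (-(2*n - 1)) (-1),
        (tp (xd n (i + 1)) (yd n (-i)) + tp (yd n i) (xd n (-i + 1)))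
  | .inr SB.t =>
      ∑ i ∈ Finset.Icc (-(2*n - 1)) (-1), tp (yd n i) (yd n (-i))

section TensorProduct

variable {n : ℤ}

@[simp] lemma tp_apply (f g : Cd n) (a b : CB n) : tp f g (a, b) = f a * g b := by
  classical
  have hs : tp f g = ∑ p ∈ f.support ×ˢ g.support, single p (f p.1 * g p.2) := by
    simp [tp, Finsupp.sum, Finset.sum_product]
  rw [hs, Finsupp.finsetSum_apply]
  simp only [single_apply, Finset.sum_ite_eq', Finset.mem_product, mem_support_iff]
  split_ifs with h
  · rfl
  · rw [not_and_or, not_not, not_not] at h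
    rcases h with h | h <;> simp [h]

lemma tp_add_left (f f' g : Cd n) : tp (f + f') g = tp f g + tp f' g := by
  ext ⟨a, b⟩; simp [add_mul]

lemma tp_add_right (f g g' : Cd n) : tp f (g + g') = tp f g + tp f g' := by
  ext ⟨a, b⟩; simp [mul_add]

@[simp] lemma zero_tp (g : Cd n) : tp 0 g = 0 := by
  ext ⟨a, b⟩; simp

@[simp] lemma tp_zero (f : Cd n) : tp f 0 = 0 := by
  ext ⟨a, b⟩; simp

lemma tp_smul_left (c : F2) (f g : Cd n) : tp (c • f) g = c • tp f g := by
  ext ⟨a, b⟩; simp [mul_assoc]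

lemma tp_smul_right (c : F2) (f g : Cd n) : tp f (c • g) = c • tp f g := by
  ext ⟨a, b⟩
  rw [tp_apply, Finsupp.smul_apply, Finsupp.smul_apply, tp_apply]
  exact mul_left_comm _ _ _

lemma tp_single_single (a b : CB n) (c c' : F2) :
    tp (single a c) (single b c') = single (a, b) (c * c') := by
  simp [tp]

/-- The Leibniz rule for `dTd`. -/
lemma dTd_tp (f g : Cd n) : dTd n (tp f g) = tp (dCd n f) g + tp f (dCd n g) := by
  induction f using Finsupp.induction_linear with
  | zero => simp
  | add f f' hf hf' => simp only [tp_add_left, map_add, hf, hf']; abel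
  | single a c =>
    induction g using Finsupp.induction_linear with
    | zero => simp
    | add g g' hg hg' => simp only [tp_add_right, map_add, hg, hg']; abel
    | single b c' =>
      rw [← smul_single_one a, ← smul_single_one b]
      simp only [tp_smul_left, tp_smul_right, map_smul, tp_single_single, mul_one, dTd,
        linearCombination_single, one_smul, smul_add]

lemma ττd_tp (f g : Cd n) : ττd n (tp f g) = tp (τCd n f) (τCd n g) := by
  induction f using Finsupp.induction_linear with
  | zero => simp
  | add f f' hf hf' => simp only [tp_add_left, map_add, hf, hf']
  | single a c =>
    induction g using Finsupp.induction_linear with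
    | zero => simp
    | add g g' hg hg' => simp only [tp_add_right, map_add, hg, hg']
    | single b c' =>
      rw [← smul_single_one a, ← smul_single_one b]
      simp only [tp_smul_left, tp_smul_right, map_smul, tp_single_single, mul_one, ττd,
        linearCombination_single, one_smul]

end TensorProduct

section DualBasis

variable (n : ℤ)

@[simp] lemma xd_apply_inl (k : ℤ) (p : XIdx n) :
    xd n k (.inl p) = if k = p.1 then 1 else 0 := by
  classical
  obtain ⟨p, hp⟩ := p
  by_cases h : k % 2 = 0 ∧ -(2*n - 2) ≤ k ∧ k ≤ 2*n - 2
  · rw [xd, dif_pos h]; simp [single_apply]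
  · rw [xd, dif_neg h, if_neg (by rintro rfl; exact h hp), coe_zero, Pi.zero_apply]

@[simp] lemma xd_apply_inr (k : ℤ) (p : YIdx n) : xd n k (.inr p) = 0 := by
  unfold xd
  split_ifs <;> simp

@[simp] lemma yd_apply_inl (k : ℤ) (p : XIdx n) : yd n k (.inl p) = 0 := by
  unfold yd
  split_ifs <;> simp

@[simp] lemma yd_apply_inr (k : ℤ) (p : YIdx n) :
    yd n k (.inr p) = if k = p.1 then 1 else 0 := by
  classical
  obtain ⟨p, hp⟩ := p
  by_cases h : k % 2 = 1 ∧ -(2*n - 1) ≤ k ∧ k ≤ 2*n - 1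
  · rw [yd, dif_pos h]; simp [single_apply]
  · rw [yd, dif_neg h, if_neg (by rintro rfl; exact h hp), coe_zero, Pi.zero_apply]

lemma xd_eq_zero {n k : ℤ} (h : ¬(k % 2 = 0 ∧ -(2*n - 2) ≤ k ∧ k ≤ 2*n - 2)) : xd n k = 0 :=
  dif_neg h

lemma yd_eq_zero {n k : ℤ} (h : ¬(k % 2 = 1 ∧ -(2*n - 1) ≤ k ∧ k ≤ 2*n - 1)) : yd n k = 0 :=
  dif_neg h

@[simp] lemma dCd_xd (k : ℤ) : dCd n (xd n k) = 0 := by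
  unfold xd
  split_ifs <;> simp [dCd]

@[simp] lemma dCd_yd (l : ℤ) : dCd n (yd n l) = xd n (l - 1) + xd n (l + 1) := by
  by_cases h : l % 2 = 1 ∧ -(2*n - 1) ≤ l ∧ l ≤ 2*n - 1
  · rw [yd, dif_pos h]; simp [dCd]
  · rw [yd_eq_zero h, xd_eq_zero (by omega), xd_eq_zero (by omega)]
    simp

@[simp] lemma τCd_xd (k : ℤ) : τCd n (xd n k) = xd n (-k) := by
  by_cases h : k % 2 = 0 ∧ -(2*n - 2) ≤ k ∧ k ≤ 2*n - 2
  · rw [xd, dif_pos h]; simp [τCd]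
  · rw [xd_eq_zero h, xd_eq_zero (by omega), map_zero]

@[simp] lemma τCd_yd (l : ℤ) : τCd n (yd n l) = yd n (-l) := by
  by_cases h : l % 2 = 1 ∧ -(2*n - 1) ≤ l ∧ l ≤ 2*n - 1
  · rw [yd, dif_pos h]; simp [τCd]
  · rw [yd_eq_zero h, yd_eq_zero (by omega), map_zero]

lemma ψ_wd (k : ℤ) : ψ n (wd n k) =
    ∑ i ∈ Finset.Icc (-(2*n - 2)) (2*n - 2),
      (tp (xd n i) (yd n (k - i)) + tp (yd n (k - i)) (xd n i)) := by
  by_cases h : k % 2 = 1 ∧ -(4*n - 3) ≤ k ∧ k ≤ 4*n - 3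
  · rw [wd, dif_pos h]; simp [ψ]
  · rw [wd, dif_neg h, map_zero, Finset.sum_eq_zero]
    intro i _
    by_cases hi : i % 2 = 0 ∧ -(2*n - 2) ≤ i ∧ i ≤ 2*n - 2
    · rw [yd_eq_zero (by omega)]; simp
    · rw [xd_eq_zero hi]; simp

lemma ψ_zd (l : ℤ) : ψ n (zd n l) =
    ∑ i ∈ Finset.Icc (-(2*n - 1)) (2*n - 1), tp (yd n i) (yd n (l - i)) := by
  by_cases h : l % 2 = 0 ∧ -(4*n - 2) ≤ l ∧ l ≤ 4*n - 2
  · rw [zd, dif_pos h]; simp [ψ]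
  · rw [zd, dif_neg h, map_zero, Finset.sum_eq_zero]
    intro i _
    by_cases hi : i % 2 = 1 ∧ -(2*n - 1) ≤ i ∧ i ≤ 2*n - 1
    · rw [yd_eq_zero (k := l - i) (by omega)]; simp
    · rw [yd_eq_zero hi]; simp

lemma ψ_r0 : ψ n (sd n SB.r0) = tp (xd n 0) (xd n 0) := by
  simp [ψ, sd]

lemma ψ_rm : ψ n (sd n SB.rm) = ∑ i ∈ Finset.Icc (-(2*n - 1)) (-1),
    (tp (xd n (i - 1)) (yd n (-i)) + tp (yd n i) (xd n (-i - 1))) := by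
  simp [ψ, sd]

lemma ψ_rp : ψ n (sd n SB.rp) = ∑ i ∈ Finset.Icc (-(2*n - 1)) (-1),
    (tp (xd n (i + 1)) (yd n (-i)) + tp (yd n i) (xd n (-i + 1))) := by
  simp [ψ, sd]

lemma ψ_t : ψ n (sd n SB.t) =
    ∑ i ∈ Finset.Icc (-(2*n - 1)) (-1), tp (yd n i) (yd n (-i)) := by
  simp [ψ, sd]

end DualBasis

lemma Ed_hom_ext {n : ℤ} {M : Type*} [AddCommGroup M] [Module F2 M] {f g : Ed n →ₗ[F2] M}
    (hw : ∀ k, f (wd n k) = g (wd n k)) (hz : ∀ l, f (zd n l) = g (zd n l))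
    (hs : ∀ s, f (sd n s) = g (sd n s)) : f = g := by
  refine Finsupp.lhom_ext' fun b => LinearMap.ext_ring ?_
  rcases b with (⟨k, hk⟩ | ⟨l, hl⟩) | s
  · have h := hw k
    rwa [wd, dif_pos hk] at h
  · have h := hz l
    rwa [zd, dif_pos hl] at h
  · exact hs s

lemma dEd_wd (n k : ℤ) : dEd n (wd n k) = 0 := by
  unfold wd
  split_ifs <;> simp [dEd]

lemma ψ_dEd_zd (n l : ℤ) : ψ n (dEd n (zd n l)) = ψ n (wd n (l - 1)) + ψ n (wd n (l + 1)) := by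
  by_cases h : l % 2 = 0 ∧ -(4*n - 2) ≤ l ∧ l ≤ 4*n - 2
  · rw [zd, dif_pos h]; simp [dEd]
  · rw [zd, wd, wd, dif_neg h, dif_neg (by omega), dif_neg (by omega)]
    simp

lemma dEd_sd (n : ℤ) (s : SB) : dEd n (sd n s) = match s with
    | SB.r0 => 0
    | SB.rm => sd n SB.r0
    | SB.rp => sd n SB.r0
    | SB.t => sd n SB.rm + sd n SB.rp := by
  cases s <;> simp [dEd, sd]

lemma τEd_sd (n : ℤ) (s : SB) : τEd n (sd n s) = match s with
    | SB.r0 => sd n SB.r0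
    | SB.rm => sd n SB.rp + wd n 1
    | SB.rp => sd n SB.rm + wd n (-1)
    | SB.t => sd n SB.t + zd n 0 := by
  cases s <;> simp [τEd, sd]

lemma τEd_wd (n k : ℤ) : τEd n (wd n k) = wd n (-k) := by
  by_cases h : k % 2 = 1 ∧ -(4*n - 3) ≤ k ∧ k ≤ 4*n - 3
  · rw [wd, dif_pos h]; simp [τEd]
  · rw [wd, wd, dif_neg h, dif_neg (by omega), map_zero]

lemma τEd_zd (n l : ℤ) : τEd n (zd n l) = zd n (-l) := by
  by_cases h : l % 2 = 0 ∧ -(4*n - 2) ≤ l ∧ l ≤ 4*n - 2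
  · rw [zd, dif_pos h]
    by_cases hl : l = 0 <;> simp [τEd, hl]
  · rw [zd, zd, dif_neg h, dif_neg (by omega), map_zero]

lemma sub_one_eq_iff (x p : ℤ) : x - 1 = p ↔ x = p + 1 := sub_eq_iff_eq_add

lemma add_one_eq_iff (x p : ℤ) : x + 1 = p ↔ x = p - 1 := eq_sub_iff_add_eq.symm

lemma dTd_ψ_wd (n k : ℤ) : dTd n (ψ n (wd n k)) = 0 := by
  have h₁ : ∀ x p, k - x = p ↔ x = k - p := fun x p => by omega
  rw [ψ_wd]
  ext ⟨⟨p, hp⟩ | ⟨p, hp⟩, ⟨q, hq⟩ | ⟨q, hq⟩⟩ <;> simp [dTd_tp]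
  simp only [ite_add_zero, Finset.sum_add_distrib, Finset.sum_ite_eq', Finset.mem_Icc]
  split_ifs <;> first | omega | decide

lemma dTd_ψ_zd (n l : ℤ) :
    dTd n (ψ n (zd n l)) = ψ n (wd n (l - 1)) + ψ n (wd n (l + 1)) := by
  have h₁ : ∀ x p, l - x = p ↔ x = l - p := fun x p => by omega
  have h₂ : ∀ x p, l - 1 - x = p ↔ x = l - 1 - p := fun x p => by omega
  have h₃ : ∀ x p, l + 1 - x = p ↔ x = l + 1 - p := fun x p => by omega
  rw [ψ_wd, ψ_wd, ψ_zd]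
  ext ⟨⟨p, hp⟩ | ⟨p, hp⟩, ⟨q, hq⟩ | ⟨q, hq⟩⟩ <;> simp [dTd_tp]
  all_goals
    simp only [ite_add_zero, Finset.sum_add_distrib, sub_one_eq_iff,
      add_one_eq_iff, h₁, h₂, h₃, Finset.sum_ite_eq', Finset.mem_Icc]
    split_ifs <;> first | omega | decide

lemma dTd_ψ_sd (n : ℤ) (s : SB) : dTd n (ψ n (sd n s)) = ψ n (dEd n (sd n s)) := by
  cases s <;> simp [dEd_sd, ψ_r0, ψ_rm, ψ_rp, ψ_t, dTd_tp]
  all_goals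
    ext ⟨⟨p, hp⟩ | ⟨p, hp⟩, ⟨q, hq⟩ | ⟨q, hq⟩⟩ <;> simp
  all_goals
    simp only [ite_add_zero, Finset.sum_add_distrib, neg_eq_iff_eq_neg, sub_one_eq_iff,
      add_one_eq_iff, Finset.sum_ite_eq', Finset.mem_Icc]
  all_goals split_ifs <;> first | omega | decide

lemma ψ_τEd_wd (n k : ℤ) : ψ n (τEd n (wd n k)) = ττd n (ψ n (wd n k)) := by
  have h₁ : ∀ x p, -k - x = p ↔ x = -k - p := fun x p => by omega
  have h₂ : ∀ x p, x - k = p ↔ x = p + k := fun x p => by omega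
  rw [τEd_wd, ψ_wd, ψ_wd]
  ext ⟨⟨p, hp⟩ | ⟨p, hp⟩, ⟨q, hq⟩ | ⟨q, hq⟩⟩ <;> simp [ττd_tp]
  all_goals
    simp only [neg_eq_iff_eq_neg, h₁, h₂, Finset.sum_ite_eq', Finset.mem_Icc]
    split_ifs <;> first | omega | decide

lemma ψ_τEd_zd (n l : ℤ) : ψ n (τEd n (zd n l)) = ττd n (ψ n (zd n l)) := by
  have h₁ : ∀ x p, -l - x = p ↔ x = -l - p := fun x p => by omega
  have h₂ : ∀ x p, x - l = p ↔ x = p + l := fun x p => by omega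
  rw [τEd_zd, ψ_zd, ψ_zd]
  ext ⟨⟨p, hp⟩ | ⟨p, hp⟩, ⟨q, hq⟩ | ⟨q, hq⟩⟩ <;> simp [ττd_tp]
  simp only [neg_eq_iff_eq_neg, h₁, h₂, Finset.sum_ite_eq', Finset.mem_Icc]
  split_ifs <;> first | omega | decide

lemma ψ_τEd_sd (n : ℤ) (hn : 1 ≤ n) (s : SB) : ψ n (τEd n (sd n s)) = ττd n (ψ n (sd n s)) := by
  have h₁ : ∀ x p : ℤ, 1 - x = p ↔ x = 1 - p := fun x p => by omega
  have h₂ : ∀ x p : ℤ, -1 - x = p ↔ x = -1 - p := fun x p => by omega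
  have h₃ : ∀ x p : ℤ, 1 + x = p ↔ x = p - 1 := fun x p => by omega
  have h₄ : ∀ x p : ℤ, -1 + x = p ↔ x = p + 1 := fun x p => by omega
  cases s <;> simp [τEd_sd, ψ_r0, ψ_rm, ψ_rp, ψ_t, ψ_wd, ψ_zd, ττd_tp]
  all_goals
    ext ⟨⟨p, hp⟩ | ⟨p, hp⟩, ⟨q, hq⟩ | ⟨q, hq⟩⟩ <;> simp
  all_goals
    simp only [neg_eq_iff_eq_neg, sub_one_eq_iff,
      add_one_eq_iff, h₁, h₂, h₃, h₄, Finset.sum_ite_eq', Finset.mem_Icc]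
  all_goals split_ifs <;> first | omega | decide

/-- The map `ψ : Ē_n^∨ → C̄_n^∨ ⊗ C̄_n^∨` is a chain map
(`∂ ∘ ψ = ψ ∘ ∂`) and is `τ`-equivariant: `ψ ∘ τ_E^∨ = (τ^∨ ⊗ τ^∨) ∘ ψ`. -/
theorem psi_is_equivariant_chain_map (n : ℤ) (hn : 1 ≤ n) :
    dTd n ∘ₗ ψ n = ψ n ∘ₗ dEd n ∧ ψ n ∘ₗ τEd n = ττd n ∘ₗ ψ n := by
  refine ⟨Ed_hom_ext (fun k => ?_) (fun l => ?_) (fun s => ?_),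
    Ed_hom_ext (fun k => ?_) (fun l => ?_) (fun s => ?_)⟩
  all_goals rw [LinearMap.comp_apply, LinearMap.comp_apply]
  · rw [dTd_ψ_wd, dEd_wd, map_zero]
  · rw [dTd_ψ_zd, ψ_dEd_zd]
  · exact dTd_ψ_sd n s
  · exact ψ_τEd_wd n k
  · exact ψ_τEd_zd n l
  · exact ψ_τEd_sd n hn s
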